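/- Let m ≥ 1, n ≥ 1, N ≥ 0 an integer, and p ∈ [1,∞]. Then sup over nonzero P ∈ P_{n,m} of |Δ^N P(0)| / ‖P‖_{L_p(B^m)} equals (2/|S^{m−1}|_{m−1})^{1/p} times sup over nonzero Q ∈ P_{2⌊n/2⌋,1,e} of |(Be_{m/2−1})^N(Q)(0)| / ‖Q‖_{L_{p,|t|^{m−1}}([−1,1])}, with the convention 1/∞ = 0 (so the factor is 1 when p = ∞). -/

import Mathlib

open MeasureTheory Filter Topology Polynomial ENNReal

noncomputable section

/-- The Laplace operator `Δ = Σ_j ∂²/∂x_j²` on functions `ℝᵐ → ℂ`. -/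
def lap {m : ℕ} (f : EuclideanSpace ℝ (Fin m) → ℂ) (x : EuclideanSpace ℝ (Fin m)) : ℂ :=
  ∑ j : Fin m, iteratedDeriv 2 (fun t : ℝ => f (x + t • EuclideanSpace.single j (1:ℝ))) 0

/-- The Bessel operator `Be_ν(φ)(r) = φ''(r) + (2ν+1)φ'(r)/r`, with the value at `0`
given by continuity (for even analytic `φ` this is `(2ν+2)φ''(0)`). -/
def besselOp (ν : ℝ) (f : ℂ → ℂ) : ℂ → ℂ := fun z =>
  if z = 0 then (2*ν+2) * deriv (deriv f) 0
  else deriv (deriv f) z + (2*ν+1) * (deriv f z / z)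

/-- Evaluation of an `m`-variate polynomial on `ℝᵐ`. -/
def mvEval {m : ℕ} (P : MvPolynomial (Fin m) ℂ) (x : EuclideanSpace ℝ (Fin m)) : ℂ :=
  MvPolynomial.eval (fun j => (x j : ℂ)) P


/-! ### Algebraic part -/

/-- Algebraic Laplacian. -/
def lapP (m : ℕ) : MvPolynomial (Fin m) ℂ →ₗ[ℂ] MvPolynomial (Fin m) ℂ :=
  ∑ j : Fin m, (MvPolynomial.pderiv j).toLinearMap ∘ₗ (MvPolynomial.pderiv j).toLinearMap

theorem lapP_apply {m : ℕ} (P : MvPolynomial (Fin m) ℂ) :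
    lapP m P = ∑ j : Fin m, MvPolynomial.pderiv j (MvPolynomial.pderiv j P) := by
  simp [lapP, LinearMap.sum_apply]

/-- Algebraic Bessel operator in the variable `s = z ^ 2`. -/
def besP (m : ℕ) (q : Polynomial ℂ) : Polynomial ℂ :=
  C 4 * X * derivative (derivative q) + C (2 * (m : ℂ)) * derivative q

/-- The squared norm polynomial. -/
def sqP (m : ℕ) : MvPolynomial (Fin m) ℂ := ∑ j : Fin m, MvPolynomial.X j ^ 2

theorem hasDerivAt_mvEval {m : ℕ} (P : MvPolynomial (Fin m) ℂ) (x : EuclideanSpace ℝ (Fin m))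
    (j : Fin m) (t : ℝ) :
    HasDerivAt (fun t : ℝ => mvEval P (x + t • EuclideanSpace.single j (1:ℝ)))
      (mvEval (MvPolynomial.pderiv j P) (x + t • EuclideanSpace.single j (1:ℝ))) t := by
  induction P using MvPolynomial.induction_on with
  | C a => simpa [mvEval] using hasDerivAt_const t a
  | add p q hp hq => 
    have h := HasDerivAt.fun_add hp hq
    simp only [mvEval, map_add] at h ⊢
    exact h
  | mul_X p i hp =>
    have h : HasDerivAt (fun t : ℝ => (((x + t • EuclideanSpace.single j (1:ℝ)) i : ℝ) : ℂ))
        ((if i = j then 1 else 0 : ℝ) : ℂ) t := by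
      apply HasDerivAt.ofReal_comp
      have := ((hasDerivAt_id t).mul_const (if i = j then (1:ℝ) else 0)).const_add (x i)
      have e : (fun t : ℝ => (x + t • EuclideanSpace.single j (1:ℝ)) i) =
          fun y : ℝ => x i + id y * (if i = j then (1:ℝ) else 0) := by
        ext s
        simp
      rw [e]
      simpa using this
    have h2 := HasDerivAt.fun_mul hp h
    simp only [mvEval, MvPolynomial.pderiv_mul, map_mul, map_add, MvPolynomial.eval_X,
      MvPolynomial.pderiv_X] at h2 ⊢
    have e : (MvPolynomial.eval fun j_1 => (((x + t • EuclideanSpace.single j (1:ℝ)) j_1 : ℝ) : ℂ))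
        (Pi.single (M := fun _ => MvPolynomial (Fin m) ℂ) j 1 i) = ((if i = j then 1 else 0 : ℝ) : ℂ) := by
      by_cases hij : i = j
      · subst hij; simp
      · simp [hij]
    rw [e]
    exact h2

theorem lap_mvEval {m : ℕ} (P : MvPolynomial (Fin m) ℂ) :
    lap (mvEval P) = mvEval (lapP m P) := by
  ext x
  have : ∀ j : Fin m,
      iteratedDeriv 2 (fun t : ℝ => mvEval P (x + t • EuclideanSpace.single j (1:ℝ))) 0 =
      mvEval (MvPolynomial.pderiv j (MvPolynomial.pderiv j P)) x := by
    intro j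
    rw [iteratedDeriv_succ, iteratedDeriv_one]
    rw [show deriv (fun t : ℝ => mvEval P (x + t • EuclideanSpace.single j (1:ℝ))) = _ from
      funext fun t => (hasDerivAt_mvEval P x j t).deriv]
    rw [(hasDerivAt_mvEval _ x j 0).deriv]
    simp
  simp only [lap, this, lapP_apply]
  simp [mvEval]

theorem lap_iter_mvEval {m : ℕ} (N : ℕ) (P : MvPolynomial (Fin m) ℂ) :
    (lap (m := m))^[N] (mvEval P) = mvEval ((lapP m)^[N] P) := by
  induction N generalizing P with
  | zero => rfl
  | succ N ih => rw [Function.iterate_succ_apply, lap_mvEval, ih, Function.iterate_succ_apply]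

theorem pderiv_aeval_sqP {m : ℕ} (q : Polynomial ℂ) (j : Fin m) :
    MvPolynomial.pderiv j (aeval (sqP m) q) =
      aeval (sqP m) (derivative q) * (2 * MvPolynomial.X j) := by
  have hR : MvPolynomial.pderiv j (sqP m) = 2 * MvPolynomial.X j := by
    simp only [sqP, map_sum, MvPolynomial.pderiv_pow, MvPolynomial.pderiv_X]
    rw [Finset.sum_eq_single j]
    · simp
    · intro b _ hb; simp [hb]
    · simp
  have := Derivation.map_aeval (MvPolynomial.pderiv (R := ℂ) j) q (sqP m)
  rw [this, hR, smul_eq_mul]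

theorem lapP_aeval {m : ℕ} (q : Polynomial ℂ) :
    lapP m (aeval (sqP m) q) = aeval (sqP m) (besP m q) := by
  rw [lapP_apply]
  simp only [pderiv_aeval_sqP, MvPolynomial.pderiv_mul]
  have h2 : ∀ j : Fin m, MvPolynomial.pderiv j (2 : MvPolynomial (Fin m) ℂ) = 0 := by
    intro j
    have := MvPolynomial.pderiv_C (R := ℂ) (a := 2) (i := j)
    rwa [show (MvPolynomial.C 2 : MvPolynomial (Fin m) ℂ) = 2 from map_ofNat _ 2] at this
  simp only [h2, MvPolynomial.pderiv_X_self]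
  simp only [besP, map_add, map_mul, aeval_X, aeval_C]
  rw [Finset.sum_add_distrib]
  congr 1
  · rw [sqP, Finset.mul_sum, Finset.sum_mul]
    apply Finset.sum_congr rfl
    intro j _
    simp only [map_ofNat]
    ring
  · simp only [map_natCast, map_ofNat]
    ring_nf
    rw [Finset.sum_const, Finset.card_univ, Fintype.card_fin, nsmul_eq_mul]
    ring

theorem lapP_iter_aeval {m : ℕ} (N : ℕ) (q : Polynomial ℂ) :
    (lapP m)^[N] (aeval (sqP m) q) = aeval (sqP m) ((besP m)^[N] q) := by
  induction N generalizing q with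
  | zero => rfl
  | succ N ih => rw [Function.iterate_succ_apply, lapP_aeval, ih, Function.iterate_succ_apply]

theorem besselOp_expand {m : ℕ} (q : Polynomial ℂ) :
    besselOp ((m : ℝ) / 2 - 1) (fun z => (expand ℂ 2 q).eval z) =
      fun z => (expand ℂ 2 (besP m q)).eval z := by
  have hd : ∀ q : Polynomial ℂ, deriv (fun z => (expand ℂ 2 q).eval z) =
      fun z => (expand ℂ 2 (derivative q) * (2 * X)).eval z := by
    intro q
    ext z
    rw [Polynomial.deriv, derivative_expand]
    simp
  have hd2 : deriv (deriv (fun z => (expand ℂ 2 q).eval z)) =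
      fun z => (4 * X ^ 2 * expand ℂ 2 (derivative (derivative q)) +
        2 * expand ℂ 2 (derivative q)).eval z := by
    rw [hd]
    ext z
    rw [Polynomial.deriv]
    simp only [derivative_mul, derivative_expand, derivative_ofNat, derivative_X]
    simp
    ring
  ext z
  simp only [besselOp]
  rw [hd2, hd]
  split_ifs with hz
  · subst hz
    simp [besP, expand_eval]
    ring
  · simp [besP, expand_eval]
    field_simp
    ring

theorem besselOp_iter_expand {m : ℕ} (N : ℕ) (q : Polynomial ℂ) :
    (besselOp ((m : ℝ) / 2 - 1))^[N] (fun z => (expand ℂ 2 q).eval z) =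
      fun z => (expand ℂ 2 ((besP m)^[N] q)).eval z := by
  induction N generalizing q with
  | zero => rfl
  | succ N ih =>
    rw [Function.iterate_succ_apply, besselOp_expand, ih, Function.iterate_succ_apply]

theorem mvEval_sqP {m : ℕ} (x : EuclideanSpace ℝ (Fin m)) :
    mvEval (sqP m) x = ((‖x‖ ^ 2 : ℝ) : ℂ) := by
  rw [EuclideanSpace.norm_sq_eq]
  simp [mvEval, sqP]

theorem mvEval_aeval_sqP {m : ℕ} (q : Polynomial ℂ) (x : EuclideanSpace ℝ (Fin m)) :
    mvEval (aeval (sqP m) q) x = (expand ℂ 2 q).eval (‖x‖ : ℂ) := by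
  have h := mvEval_sqP x
  rw [expand_eval]
  have : mvEval (aeval (sqP m) q) x = q.eval (mvEval (sqP m) x) := by
    simp only [mvEval]
    rw [← Polynomial.coe_aeval_eq_eval, ← MvPolynomial.coe_aeval_eq_eval]
    simp only [RingHom.coe_coe]
    rw [Polynomial.aeval_algHom_apply]
  rw [this, h]
  push_cast; rfl

theorem op_eq {m : ℕ} (N : ℕ) (q : Polynomial ℂ) :
    (lap (m := m))^[N] (mvEval (aeval (sqP m) q)) 0 =
      (besselOp ((m : ℝ) / 2 - 1))^[N] (fun z => (expand ℂ 2 q).eval z) 0 := by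
  rw [lap_iter_mvEval, lapP_iter_aeval, besselOp_iter_expand, mvEval_aeval_sqP]
  simp

theorem even_eq_expand (Q : Polynomial ℂ) (hQ : ∀ z : ℂ, Q.eval (-z) = Q.eval z) :
    Q = expand ℂ 2 (contract 2 Q) := by
  have h : Q.comp (C (-1) * X) = Q := by
    apply Polynomial.funext
    intro r; simp [hQ]
  ext k
  rw [coeff_expand (by norm_num)]
  split_ifs with hk
  · rw [coeff_contract (by norm_num), Nat.div_mul_cancel hk]
  · have h1 := congrArg (fun p => coeff p k) h
    simp only [Polynomial.comp_C_mul_X_coeff] at h1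
    have : (-1 : ℂ) ^ k = -1 := Odd.neg_one_pow (Nat.not_even_iff_odd.1 fun h => hk h.two_dvd)
    rw [this] at h1
    have h2 : (2:ℂ) * Q.coeff k = 0 := by linear_combination -h1
    simpa using h2

theorem isHomogeneous_sqP (m : ℕ) : (sqP m).IsHomogeneous 2 := by
  apply MvPolynomial.IsHomogeneous.sum
  intro j _
  exact MvPolynomial.isHomogeneous_X_pow j 2

theorem totalDegree_aeval {m : ℕ} (q : Polynomial ℂ) :
    (aeval (sqP m) q).totalDegree ≤ 2 * q.natDegree := by
  rw [aeval_eq_sum_range]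
  apply MvPolynomial.totalDegree_finsetSum_le
  intro i hi
  refine (MvPolynomial.totalDegree_smul_le _ _).trans ?_
  refine ((isHomogeneous_sqP m).pow i).totalDegree_le.trans ?_
  have := Finset.mem_range.1 hi
  omega

theorem lapP_isHomogeneous {m k : ℕ} {P : MvPolynomial (Fin m) ℂ} (h : P.IsHomogeneous k) :
    (lapP m P).IsHomogeneous (k - 2) := by
  rw [lapP_apply]
  apply MvPolynomial.IsHomogeneous.sum
  intro j _
  exact (h.pderiv).pderiv

theorem lapP_eq_zero {m k : ℕ} {P : MvPolynomial (Fin m) ℂ} (h : P.IsHomogeneous k) (hk : k < 2) :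
    lapP m P = 0 := by
  rw [lapP_apply]
  apply Finset.sum_eq_zero
  intro j _
  have h1 : (MvPolynomial.pderiv j P).IsHomogeneous 0 := by
    have := h.pderiv (i := j)
    rwa [show k - 1 = 0 by omega] at this
  rw [← MvPolynomial.totalDegree_zero_iff_isHomogeneous] at h1
  rw [MvPolynomial.totalDegree_eq_zero_iff_eq_C.1 h1, MvPolynomial.pderiv_C]

theorem mvEval_smul {m k : ℕ} {P : MvPolynomial (Fin m) ℂ} (h : P.IsHomogeneous k) (r : ℝ)
    (x : EuclideanSpace ℝ (Fin m)) : mvEval P (r • x) = (r : ℂ) ^ k * mvEval P x := by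
  simp only [mvEval, MvPolynomial.eval_eq']
  rw [Finset.mul_sum]
  apply Finset.sum_congr rfl
  intro d hd
  have hdeg : ∑ i, d i = k := by
    have := h (MvPolynomial.mem_support_iff.1 hd)
    rw [← this, Finsupp.weight_apply, Finsupp.sum_fintype] <;> simp
  have : ∀ i, (((r • x) i : ℝ) : ℂ) ^ d i = (r : ℂ) ^ d i * (x i : ℂ) ^ d i := by
    intro i; simp [mul_pow]
  simp only [this, Finset.prod_mul_distrib, Finset.prod_pow_eq_pow_sum, hdeg]
  ring

theorem lapP_iter_zero_of_ne {m k N : ℕ} {P : MvPolynomial (Fin m) ℂ} (h : P.IsHomogeneous k)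
    (hk : k ≠ 2 * N) : mvEval ((lapP m)^[N] P) 0 = 0 := by
  induction N generalizing k P with
  | zero =>
    simp only [Function.iterate_zero, id_eq, mvEval]
    have := mvEval_smul h 0 0
    rw [zero_smul, Complex.ofReal_zero, zero_pow (by simpa using hk), zero_mul] at this
    exact this
  | succ N ih =>
    rw [Function.iterate_succ_apply]
    by_cases h2 : k < 2
    · rw [lapP_eq_zero h h2]
      have : (lapP m)^[N] 0 = 0 := by
        rw [← Module.End.pow_apply]; simp
      rw [this]; simp [mvEval]
    · exact ih (lapP_isHomogeneous h) (by omega)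

/-! ### Gaussian and spherical means -/

theorem continuous_mvEval {m : ℕ} (P : MvPolynomial (Fin m) ℂ) : Continuous (mvEval P) := by
  unfold mvEval
  exact (MvPolynomial.continuous_eval P).comp (by fun_prop)

/-- Gaussian weight. -/
def gw {m : ℕ} (x : EuclideanSpace ℝ (Fin m)) : ℂ := ((Real.exp (-(1/2) * ‖x‖ ^ 2) : ℝ) : ℂ)

theorem integrable_gauss1 (k : ℕ) :
    Integrable (fun t : ℝ => (t : ℂ) ^ k * ((Real.exp (-(1/2) * t ^ 2) : ℝ) : ℂ)) := by
  have h := integrable_rpow_mul_exp_neg_mul_sq (b := 1/2) (by norm_num) (s := (k : ℝ))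
    (by have : (0:ℝ) ≤ k := Nat.cast_nonneg k
        linarith)
  have h2 := h.ofReal (𝕜 := ℂ)
  refine h2.congr (Eventually.of_forall fun t => ?_)
  simp

theorem integrable_gauss {m : ℕ} (P : MvPolynomial (Fin m) ℂ) :
    Integrable (fun x : EuclideanSpace ℝ (Fin m) => mvEval P x * gw x) := by
  induction P using MvPolynomial.induction_on' with
  | add p q hp hq =>
    have := hp.add hq
    refine this.congr (Eventually.of_forall fun x => ?_)
    simp [mvEval, add_mul]
  | monomial d a =>
    have h1 : Integrable (fun y : Fin m → ℝ =>
        ∏ i, ((y i : ℂ) ^ (d i) * ((Real.exp (-(1/2) * (y i) ^ 2) : ℝ) : ℂ))) :=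
      Integrable.fintype_prod (f := fun i (t : ℝ) =>
        (t : ℂ) ^ (d i) * ((Real.exp (-(1/2) * t ^ 2) : ℝ) : ℂ)) (fun i => integrable_gauss1 (d i))
    have h2 := ((PiLp.volume_preserving_ofLp (Fin m)).integrable_comp_emb
      (MeasurableEquiv.toLp 2 (Fin m → ℝ)).symm.measurableEmbedding).2 h1
    refine (h2.const_mul a).congr (Eventually.of_forall fun x => ?_)
    simp only [Function.comp, mvEval, gw, MvPolynomial.eval_monomial, EuclideanSpace.norm_sq_eq,
      Finset.prod_mul_distrib]
    rw [Finset.mul_sum, Real.exp_sum]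
    simp only [Complex.ofReal_prod, Real.norm_eq_abs, sq_abs]
    rw [Finsupp.prod_fintype _ _ (by simp)]
    ring

/-- Gaussian integral. -/
def gE {m : ℕ} (P : MvPolynomial (Fin m) ℂ) : ℂ :=
  ∫ x : EuclideanSpace ℝ (Fin m), mvEval P x * gw x

theorem gE_add {m : ℕ} (P Q : MvPolynomial (Fin m) ℂ) : gE (P + Q) = gE P + gE Q := by
  unfold gE
  rw [← integral_add (integrable_gauss P) (integrable_gauss Q)]
  congr 1; ext x; simp [mvEval, add_mul]

theorem gE_C_mul {m : ℕ} (a : ℂ) (P : MvPolynomial (Fin m) ℂ) :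
    gE (MvPolynomial.C a * P) = a * gE P := by
  unfold gE
  rw [← integral_const_mul]
  congr 1; ext x; simp [mvEval, mul_assoc]

theorem gE_sum {m : ℕ} {ι : Type*} (s : Finset ι) (f : ι → MvPolynomial (Fin m) ℂ) :
    gE (∑ i ∈ s, f i) = ∑ i ∈ s, gE (f i) := by
  classical
  induction s using Finset.induction_on with
  | empty => simp [gE, mvEval]
  | insert a s ha ih => rw [Finset.sum_insert ha, gE_add, ih, Finset.sum_insert ha]

theorem hasDerivAt_gw {m : ℕ} (x : EuclideanSpace ℝ (Fin m)) (j : Fin m) :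
    HasDerivAt (fun t : ℝ => gw (x + t • EuclideanSpace.single j (1:ℝ))) (-(x j : ℂ) * gw x) 0 := by
  have hsq : HasDerivAt (fun t : ℝ => ‖x + t • EuclideanSpace.single j (1:ℝ)‖ ^ 2) (2 * x j) 0 := by
    have e : (fun t : ℝ => ‖x + t • EuclideanSpace.single j (1:ℝ)‖ ^ 2) =
        fun t : ℝ => ‖x‖ ^ 2 + t * (2 * x j) + t ^ 2 := by
      ext t
      have hi : inner ℝ x (EuclideanSpace.single j (1:ℝ)) = x j := by
        rw [EuclideanSpace.inner_single_right]; simp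
      rw [norm_add_sq_real, inner_smul_right, norm_smul, mul_pow, hi]
      simp
      ring
    rw [e]
    have h := HasDerivAt.fun_add (((hasDerivAt_id (0:ℝ)).mul_const (2 * x j)).const_add (‖x‖ ^ 2))
      (hasDerivAt_pow 2 (0:ℝ))
    simpa using h
  have h2 := ((hsq.const_mul (-(1/2))).exp).ofReal_comp
  unfold gw
  convert h2 using 1
  simp
  ring

theorem gE_X_mul {m : ℕ} (P : MvPolynomial (Fin m) ℂ) (j : Fin m) :
    gE (MvPolynomial.X j * P) = gE (MvPolynomial.pderiv j P) := by
  have key := integral_bilinear_hasLineDerivAt_right_eq_neg_left_of_integrable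
    (μ := (volume : Measure (EuclideanSpace ℝ (Fin m))))
    (f := mvEval P) (f' := mvEval (MvPolynomial.pderiv j P)) (g := gw)
    (g' := fun x => -(x j : ℂ) * gw x) (v := EuclideanSpace.single j (1:ℝ))
    (B := ContinuousLinearMap.mul ℝ ℂ)
    (by simpa using integrable_gauss (MvPolynomial.pderiv j P))
    (by
      refine (integrable_gauss (MvPolynomial.X j * P)).neg.congr (Eventually.of_forall fun x => ?_)
      simp [mvEval]; ring)
    (by simpa using integrable_gauss P)
    (fun x _ => by
      have := hasDerivAt_mvEval P x j 0
      simpa [HasLineDerivAt] using this)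
    (fun x _ => hasDerivAt_gw x j)
  simp only [ContinuousLinearMap.mul_apply'] at key
  unfold gE
  rw [← neg_inj, ← key, ← integral_neg]
  congr 1
  ext x
  simp [mvEval]
  ring

theorem gE_euler {m k : ℕ} {P : MvPolynomial (Fin m) ℂ} (h : P.IsHomogeneous k) :
    gE (lapP m P) = k * gE P := by
  rw [lapP_apply, gE_sum]
  simp only [← gE_X_mul]
  rw [← gE_sum, h.sum_X_mul_pderiv, nsmul_eq_mul, ← gE_C_mul]
  simp

theorem lapP_iter_isHomogeneous {m k : ℕ} (N : ℕ) {P : MvPolynomial (Fin m) ℂ}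
    (h : P.IsHomogeneous k) : ((lapP m)^[N] P).IsHomogeneous (k - 2 * N) := by
  induction N generalizing k P with
  | zero => simpa using h
  | succ N ih =>
    have := ih (lapP_isHomogeneous h)
    rw [Function.iterate_succ_apply]
    rwa [show k - 2 * (N + 1) = k - 2 - 2 * N by omega]

theorem gE_iter (m N : ℕ) : ∃ d : ℂ, ∀ P : MvPolynomial (Fin m) ℂ, P.IsHomogeneous (2 * N) →
    gE ((lapP m)^[N] P) = d * gE P := by
  induction N with
  | zero => exact ⟨1, fun P _ => by simp⟩
  | succ N ih =>
    obtain ⟨d, hd⟩ := ih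
    refine ⟨d * ((2 * (N + 1) : ℕ) : ℂ), fun P hP => ?_⟩
    rw [Function.iterate_succ_apply, hd _ (lapP_isHomogeneous hP), gE_euler hP]
    ring

theorem gE_const {m : ℕ} {P : MvPolynomial (Fin m) ℂ} (h : P.IsHomogeneous 0) :
    gE P = mvEval P 0 * gE (1 : MvPolynomial (Fin m) ℂ) := by
  rw [← MvPolynomial.totalDegree_zero_iff_isHomogeneous,
    MvPolynomial.totalDegree_eq_zero_iff_eq_C] at h
  rw [h, ← gE_C_mul]
  simp [mvEval]

theorem gE_one_ne_zero (m : ℕ) : gE (1 : MvPolynomial (Fin m) ℂ) ≠ 0 := by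
  have h := GaussianFourier.integral_rexp_neg_mul_sq_norm (V := EuclideanSpace ℝ (Fin m))
    (b := 1/2) (by norm_num)
  have : gE (1 : MvPolynomial (Fin m) ℂ) =
      ((∫ v : EuclideanSpace ℝ (Fin m), Real.exp (-(1/2) * ‖v‖ ^ 2) : ℝ) : ℂ) := by
    rw [← integral_complex_ofReal]
    simp [gE, mvEval, gw]
  rw [this, h]
  have : 0 < (Real.pi / (1/2)) := by positivity
  exact_mod_cast (Real.rpow_pos_of_pos this _).ne'

/-- Surface measure. -/
abbrev sph (m : ℕ) : Measure (Metric.sphere (0 : EuclideanSpace ℝ (Fin m)) 1) :=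
  (volume : Measure (EuclideanSpace ℝ (Fin m))).toSphere

/-- Integral over the sphere. -/
def Sph {m : ℕ} (P : MvPolynomial (Fin m) ℂ) : ℂ :=
  ∫ θ : Metric.sphere (0 : EuclideanSpace ℝ (Fin m)) 1, mvEval P θ ∂(sph m)

theorem mp_polar (m : ℕ) :
    MeasurePreserving (homeomorphUnitSphereProd (EuclideanSpace ℝ (Fin m)))
      ((volume : Measure (EuclideanSpace ℝ (Fin m))).comap Subtype.val) ((sph m).prod (Measure.volumeIoiPow (m - 1))) := by
  have := (volume : Measure (EuclideanSpace ℝ (Fin m))).measurePreserving_homeomorphUnitSphereProd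
  simpa using this

theorem gE_polar {m : ℕ} (hm : 1 ≤ m) (k : ℕ) : ∃ R : ℂ, ∀ P : MvPolynomial (Fin m) ℂ,
    P.IsHomogeneous k → gE P = Sph P * R := by
  refine ⟨∫ r : Set.Ioi (0:ℝ), ((r.1 : ℂ) ^ k * ((Real.exp (-(1/2) * r.1 ^ 2) : ℝ) : ℂ))
    ∂(Measure.volumeIoiPow (m - 1)), fun P hP => ?_⟩
  have : Nonempty (Fin m) := ⟨⟨0, hm⟩⟩
  unfold gE Sph
  rw [← integral_prod_mul, ← (mp_polar m).integral_comp (Homeomorph.measurableEmbedding _)]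
  rw [← restrict_compl_singleton (μ := (volume : Measure (EuclideanSpace ℝ (Fin m)))) 0,
    ← integral_subtype_comap (by measurability)]
  · congr 1
    · simp
    ext x
    have hx : (x : EuclideanSpace ℝ (Fin m)) =
      ((homeomorphUnitSphereProd _ x).2 : ℝ) • ((homeomorphUnitSphereProd _ x).1 : EuclideanSpace ℝ (Fin m)) := by
      have := (homeomorphUnitSphereProd _).symm_apply_apply x
      conv_lhs => rw [← this]
      rfl
    conv_lhs => rw [hx]
    rw [mvEval_smul hP]
    have hgw : ∀ (r : ℝ) (θ : Metric.sphere (0 : EuclideanSpace ℝ (Fin m)) 1),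
        gw (r • (θ : EuclideanSpace ℝ (Fin m))) = ((Real.exp (-(1/2) * r ^ 2) : ℝ) : ℂ) := by
      intro r θ
      simp [gw, norm_smul]
    rw [hgw]
    ring

theorem Sph_one {m : ℕ} : Sph (1 : MvPolynomial (Fin m) ℂ) = ((sph m).real Set.univ : ℂ) := by
  simp [Sph, mvEval]

theorem sph_univ_ne_zero {m : ℕ} (hm : 1 ≤ m) : (sph m) Set.univ ≠ 0 := by
  have : Nonempty (Fin m) := ⟨⟨0, hm⟩⟩
  rw [Ne, Measure.measure_univ_eq_zero]
  exact Measure.toSphere_ne_zero _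

theorem Sph_one_ne_zero {m : ℕ} (hm : 1 ≤ m) : Sph (1 : MvPolynomial (Fin m) ℂ) ≠ 0 := by
  rw [Sph_one]
  have : (sph m).real Set.univ ≠ 0 := by
    rw [measureReal_def]
    exact (ENNReal.toReal_pos (sph_univ_ne_zero hm) (measure_ne_top _ _)).ne'
  exact_mod_cast this

theorem Sph_sq {m : ℕ} (N : ℕ) : Sph (sqP m ^ N) = Sph (1 : MvPolynomial (Fin m) ℂ) := by
  unfold Sph
  congr 1
  ext θ
  have := mvEval_sqP (θ : EuclideanSpace ℝ (Fin m))
  simp only [mvEval, map_pow] at this ⊢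
  rw [this]; simp

theorem pizzetti {m : ℕ} (hm : 1 ≤ m) (N : ℕ) {P : MvPolynomial (Fin m) ℂ}
    (hP : P.IsHomogeneous (2 * N)) :
    mvEval ((lapP m)^[N] P) 0 =
      Sph P / Sph (1 : MvPolynomial (Fin m) ℂ) * mvEval ((lapP m)^[N] (sqP m ^ N)) 0 := by
  obtain ⟨d, hd⟩ := gE_iter m N
  obtain ⟨R, hR⟩ := gE_polar hm (2 * N)
  have hS : (sqP m ^ N).IsHomogeneous (2 * N) := (isHomogeneous_sqP m).pow N
  have key : ∀ P : MvPolynomial (Fin m) ℂ, P.IsHomogeneous (2 * N) →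
      mvEval ((lapP m)^[N] P) 0 * gE (1 : MvPolynomial (Fin m) ℂ) = d * (Sph P * R) := by
    intro P hP
    have := lapP_iter_isHomogeneous N hP
    rw [← hR P hP, ← hd P hP, ← gE_const]
    simpa using this
  have h1 := key P hP
  have h2 := key _ hS
  rw [Sph_sq] at h2
  have := Sph_one_ne_zero hm
  have hg := gE_one_ne_zero m
  field_simp
  apply mul_right_cancel₀ hg
  linear_combination Sph (1 : MvPolynomial (Fin m) ℂ) * h1 - Sph P * h2

theorem mp_neg_sph (m : ℕ) : MeasurePreserving
    (fun θ : Metric.sphere (0 : EuclideanSpace ℝ (Fin m)) 1 => -θ) (sph m) (sph m) := by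
  have hmeas : Measurable (fun θ : Metric.sphere (0 : EuclideanSpace ℝ (Fin m)) 1 => -θ) :=
    continuous_neg.measurable
  refine ⟨hmeas, ?_⟩
  ext s hs
  rw [Measure.map_apply hmeas hs, Measure.toSphere_apply' _ hs,
    Measure.toSphere_apply' _ (hmeas hs)]
  congr 1
  rw [← Measure.measure_neg]
  congr 1
  ext x
  simp only [Set.mem_neg, Set.mem_smul, Set.mem_image, Set.mem_preimage]
  constructor
  · rintro ⟨r, hr, y, ⟨z, hz, rfl⟩, h⟩
    refine ⟨r, hr, _, ⟨-z, hz, rfl⟩, ?_⟩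
    simp [h]
  · rintro ⟨r, hr, y, ⟨z, hz, rfl⟩, h⟩
    refine ⟨r, hr, _, ⟨-z, by simpa using hz, rfl⟩, ?_⟩
    simp [h]

theorem Sph_odd {m k : ℕ} (hk : Odd k) {P : MvPolynomial (Fin m) ℂ} (hP : P.IsHomogeneous k) :
    Sph P = 0 := by
  have h : ∫ θ, mvEval P ((-θ : Metric.sphere (0 : EuclideanSpace ℝ (Fin m)) 1) :
      EuclideanSpace ℝ (Fin m)) ∂(sph m) = Sph P :=
    (mp_neg_sph m).integral_comp (Homeomorph.neg _).measurableEmbedding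
      (fun θ => mvEval P (θ : EuclideanSpace ℝ (Fin m)))
  have h2 : ∀ θ : Metric.sphere (0 : EuclideanSpace ℝ (Fin m)) 1,
      mvEval P ((-θ : Metric.sphere (0 : EuclideanSpace ℝ (Fin m)) 1) :
      EuclideanSpace ℝ (Fin m)) = - mvEval P θ := by
    intro θ
    have := mvEval_smul hP (-1) (θ : EuclideanSpace ℝ (Fin m))
    simpa [hk.neg_one_pow] using this
  simp only [h2] at h
  rw [integral_neg] at h
  change - Sph P = Sph P at h
  have : (2:ℂ) * Sph P = 0 := by linear_combination -h
  simpa using this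

/-! ### Norms -/

theorem eLpNorm_integral_le {α β : Type*} [MeasurableSpace α] [MeasurableSpace β]
    (μ : Measure α) [IsProbabilityMeasure μ] (ρ : Measure β) [SFinite ρ] (p : ℝ≥0∞) (hp : 1 ≤ p)
    (F : α × β → ℂ) (hF : StronglyMeasurable F) :
    eLpNorm (fun b => ∫ a, F (a, b) ∂μ) p ρ ≤ eLpNorm F p (μ.prod ρ) := by
  have hFb : ∀ b, AEStronglyMeasurable (fun a => F (a, b)) μ := fun b =>
    (hF.comp_measurable measurable_prodMk_right).aestronglyMeasurable
  have h1 : ∀ b, ‖∫ a, F (a, b) ∂μ‖ₑ ≤ eLpNorm (fun a => F (a, b)) p μ := fun b =>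
    (enorm_integral_le_lintegral_enorm _).trans
      ((eLpNorm_one_eq_lintegral_enorm (f := fun a => F (a, b))).symm.le.trans
        (eLpNorm_le_eLpNorm_of_exponent_le hp (hFb b)))
  by_cases hpt : p = ∞
  · subst hpt
    rw [eLpNorm_exponent_top, eLpNorm_exponent_top]
    have h2 : ∀ᵐ z ∂(μ.prod ρ), ‖F z‖ₑ ≤ eLpNormEssSup F (μ.prod ρ) :=
      enorm_ae_le_eLpNormEssSup F _
    have h3 : ∀ᵐ z ∂(ρ.prod μ), ‖F z.swap‖ₑ ≤ eLpNormEssSup F (μ.prod ρ) :=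
      Measure.measurePreserving_swap.quasiMeasurePreserving.ae h2
    have h4 := Measure.ae_ae_of_ae_prod h3
    refine essSup_le_of_ae_le _ ?_
    filter_upwards [h4] with b hb
    refine (h1 b).trans ?_
    rw [eLpNorm_exponent_top]
    exact essSup_le_of_ae_le _ hb
  · have hp0 : p ≠ 0 := (zero_lt_one.trans_le hp).ne'
    have hpos : 0 < p.toReal := ENNReal.toReal_pos hp0 hpt
    rw [eLpNorm_eq_lintegral_rpow_enorm_toReal hp0 hpt, eLpNorm_eq_lintegral_rpow_enorm_toReal hp0 hpt]
    refine ENNReal.rpow_le_rpow ?_ (by positivity)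
    rw [lintegral_prod_symm _ (by fun_prop)]
    refine lintegral_mono fun b => ?_
    refine (ENNReal.rpow_le_rpow (h1 b) hpos.le).trans ?_
    rw [eLpNorm_eq_lintegral_rpow_enorm_toReal hp0 hpt, ← ENNReal.rpow_mul, one_div,
      inv_mul_cancel₀ hpos.ne', ENNReal.rpow_one]

/-- Radial measure on `(0,1]`. -/
def rad (m : ℕ) : Measure (Set.Ioi (0:ℝ)) :=
  (Measure.volumeIoiPow (m - 1)).restrict {r | r.1 ≤ 1}

instance (m : ℕ) : SigmaFinite (rad m) := by unfold rad; infer_instance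

theorem mp_ball {m : ℕ} (hm : 1 ≤ m) : MeasurePreserving
    (fun z : Metric.sphere (0 : EuclideanSpace ℝ (Fin m)) 1 × Set.Ioi (0:ℝ) =>
      (z.2 : ℝ) • (z.1 : EuclideanSpace ℝ (Fin m)))
    ((sph m).prod (rad m))
    (volume.restrict (Metric.closedBall (0 : EuclideanSpace ℝ (Fin m)) 1)) := by
  have : Nonempty (Fin m) := ⟨⟨0, hm⟩⟩
  have h1 : MeasurePreserving (homeomorphUnitSphereProd (EuclideanSpace ℝ (Fin m))).symm
      ((sph m).prod (Measure.volumeIoiPow (m - 1)))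
      ((volume : Measure (EuclideanSpace ℝ (Fin m))).comap Subtype.val) :=
    (mp_polar m).symm (homeomorphUnitSphereProd (EuclideanSpace ℝ (Fin m))).toMeasurableEquiv
  have h2 : MeasurePreserving (Subtype.val : ({0}ᶜ : Set (EuclideanSpace ℝ (Fin m))) → _)
      ((volume : Measure (EuclideanSpace ℝ (Fin m))).comap Subtype.val) volume := by
    refine ⟨measurable_subtype_coe, ?_⟩
    rw [map_comap_subtype_coe (by measurability), restrict_compl_singleton]
  have h3 := (h2.comp h1).restrict_preimage
    (Metric.isClosed_closedBall (x := (0 : EuclideanSpace ℝ (Fin m))) (ε := 1)).measurableSet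
  have h4 : ((Subtype.val ∘ (homeomorphUnitSphereProd (EuclideanSpace ℝ (Fin m))).symm) ⁻¹'
      Metric.closedBall (0 : EuclideanSpace ℝ (Fin m)) 1) = Set.univ ×ˢ {r : Set.Ioi (0:ℝ) | r.1 ≤ 1} := by
    ext z
    have hz : (0:ℝ) < z.2 := z.2.2
    simp [norm_smul, abs_of_pos hz]
  rw [h4, ← Measure.prod_restrict, Measure.restrict_univ] at h3
  exact h3

/-- The weighted measure on `[-1,1]`. -/
def wV (m : ℕ) : Measure ℝ := (volume.restrict (Set.Icc (-1 : ℝ) 1)).withDensity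
                fun t => ENNReal.ofReal (|t| ^ (m - 1))

theorem rad_apply (m : ℕ) {s : Set ℝ} (hs : MeasurableSet s) :
    (rad m).map Subtype.val s =
      ∫⁻ t in s ∩ Set.Ioc 0 1, ENNReal.ofReal (|t| ^ (m - 1)) := by
  have hle : MeasurableSet {r : Set.Ioi (0:ℝ) | r.1 ≤ 1} :=
    measurableSet_le measurable_subtype_coe measurable_const
  rw [Measure.map_apply measurable_subtype_coe hs, rad,
    Measure.restrict_apply (measurable_subtype_coe hs), Measure.volumeIoiPow,
    withDensity_apply _ ((measurable_subtype_coe hs).inter hle),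
    setLIntegral_subtype measurableSet_Ioi _ fun a : ℝ ↦ .ofReal (a ^ (m - 1))]
  have : (Subtype.val '' ((Subtype.val ⁻¹' s) ∩ {r : Set.Ioi (0:ℝ) | r.1 ≤ 1})) =
      s ∩ Set.Ioc 0 1 := by
    ext t
    constructor
    · rintro ⟨r, ⟨h1, h2⟩, rfl⟩
      exact ⟨h1, r.2, h2⟩
    · rintro ⟨h1, h2, h3⟩
      exact ⟨⟨t, h2⟩, ⟨h1, h3⟩, rfl⟩
  rw [this]
  refine setLIntegral_congr_fun (hs.inter measurableSet_Ioc) fun t ht => ?_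
  simp only [abs_of_pos ht.2.1]

theorem wV_map_abs (m : ℕ) : (wV m).map (fun t => |t|) = (2 : ℝ≥0∞) • (rad m).map Subtype.val := by
  have habs : Measurable (fun t : ℝ => |t|) := continuous_abs.measurable
  ext s hs
  rw [Measure.smul_apply, rad_apply m hs, Measure.map_apply habs hs, wV,
    withDensity_apply _ (habs hs), Measure.restrict_restrict (habs hs), smul_eq_mul]
  set A := s ∩ Set.Ioc (0:ℝ) 1 with hA
  have hAm : MeasurableSet A := hs.inter measurableSet_Ioc
  have hae : ((fun t : ℝ => |t|) ⁻¹' s ∩ Set.Icc (-1) 1 : Set ℝ) =ᵐ[volume] (A ∪ (Neg.neg ⁻¹' A) : Set ℝ) := by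
    have h0 : ∀ᵐ t : ℝ ∂volume, t ≠ 0 := by
      simp [ae_iff]
    filter_upwards [h0] with t ht
    apply propext
    change (|t| ∈ s ∧ t ∈ Set.Icc (-1:ℝ) 1) ↔ (t ∈ A ∨ -t ∈ A)
    simp only [hA, Set.mem_inter_iff, Set.mem_Icc, Set.mem_Ioc]
    rcases lt_or_gt_of_ne ht with h | h
    · rw [abs_of_neg h]
      constructor
      · rintro ⟨h1, h2, h3⟩; right; exact ⟨h1, by linarith, by linarith⟩
      · rintro (⟨h1, h2, h3⟩ | ⟨h1, h2, h3⟩)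
        · linarith
        · exact ⟨h1, by linarith, by linarith⟩
    · rw [abs_of_pos h]
      constructor
      · rintro ⟨h1, h2, h3⟩; left; exact ⟨h1, by linarith, by linarith⟩
      · rintro (⟨h1, h2, h3⟩ | ⟨h1, h2, h3⟩)
        · exact ⟨h1, by linarith, by linarith⟩
        · linarith
  rw [setLIntegral_congr hae, lintegral_union (measurable_neg hAm)]
  · have := (Measure.measurePreserving_neg (volume : Measure ℝ)).setLIntegral_comp_preimage hAm
      (f := fun t => ENNReal.ofReal (|t| ^ (m - 1))) (by fun_prop)
    simp only [abs_neg] at this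
    rw [this, two_mul]
  · rw [Set.disjoint_left]
    rintro t ⟨_, h1, _⟩ ⟨_, h2, _⟩
    linarith

theorem eLpNorm_wV (m : ℕ) (q : Polynomial ℂ) (p : ℝ≥0∞) :
    eLpNorm (fun t : ℝ => (expand ℂ 2 q).eval (t : ℂ)) p (wV m) =
      2 ^ (1 / p).toReal *
        eLpNorm (fun r : Set.Ioi (0:ℝ) => (expand ℂ 2 q).eval ((r : ℝ) : ℂ)) p (rad m) := by
  have hc : Continuous (fun t : ℝ => (expand ℂ 2 q).eval (t : ℂ)) :=
    (Polynomial.continuous _).comp Complex.continuous_ofReal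
  have he : (fun t : ℝ => (expand ℂ 2 q).eval (t : ℂ)) =
      (fun t : ℝ => (expand ℂ 2 q).eval (t : ℂ)) ∘ (fun t => |t|) := by
    ext t
    simp only [Function.comp, expand_eval]
    congr 1
    rw [← Complex.ofReal_pow, ← Complex.ofReal_pow, sq_abs]
  rw [he, ← eLpNorm_map_measure hc.aestronglyMeasurable continuous_abs.measurable.aemeasurable,
    wV_map_abs, eLpNorm_smul_measure_of_ne_zero (by norm_num),
    eLpNorm_map_measure hc.aestronglyMeasurable measurable_subtype_coe.aemeasurable, smul_eq_mul]
  rfl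

theorem eLpNorm_ball_radial {m : ℕ} (hm : 1 ≤ m) (q : Polynomial ℂ) (p : ℝ≥0∞) :
    eLpNorm (mvEval (aeval (sqP m) q)) p
      (volume.restrict (Metric.closedBall (0 : EuclideanSpace ℝ (Fin m)) 1)) =
      (sph m Set.univ) ^ (1 / p).toReal *
        eLpNorm (fun r : Set.Ioi (0:ℝ) => (expand ℂ 2 q).eval ((r : ℝ) : ℂ)) p (rad m) := by
  have hc : Continuous (fun t : Set.Ioi (0:ℝ) => (expand ℂ 2 q).eval ((t : ℝ) : ℂ)) :=
    (Polynomial.continuous _).comp (Complex.continuous_ofReal.comp continuous_subtype_val)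
  rw [← eLpNorm_comp_measurePreserving (continuous_mvEval _).aestronglyMeasurable (mp_ball hm)]
  have he : (mvEval (aeval (sqP m) q) ∘
      (fun z : Metric.sphere (0 : EuclideanSpace ℝ (Fin m)) 1 × Set.Ioi (0:ℝ) =>
      (z.2 : ℝ) • (z.1 : EuclideanSpace ℝ (Fin m)))) =
      (fun r : Set.Ioi (0:ℝ) => (expand ℂ 2 q).eval ((r : ℝ) : ℂ)) ∘ Prod.snd := by
    ext z
    have hz : (0:ℝ) < z.2 := z.2.2
    simp only [Function.comp, mvEval_aeval_sqP]
    simp [norm_smul, abs_of_pos hz]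
  rw [he, ← eLpNorm_map_measure hc.aestronglyMeasurable measurable_snd.aemeasurable,
    Measure.map_snd_prod, eLpNorm_smul_measure_of_ne_zero (sph_univ_ne_zero hm), smul_eq_mul]

theorem eLpNorm_ball_ge {m : ℕ} (hm : 1 ≤ m) (P : MvPolynomial (Fin m) ℂ) (Q : ℝ → ℂ)
    (p : ℝ≥0∞) (hp : 1 ≤ p)
    (hQ : ∀ r : ℝ, 0 < r → Q r * Sph (1 : MvPolynomial (Fin m) ℂ) =
      ∫ θ : Metric.sphere (0 : EuclideanSpace ℝ (Fin m)) 1,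
        mvEval P (r • (θ : EuclideanSpace ℝ (Fin m))) ∂(sph m)) :
    (sph m Set.univ) ^ (1 / p).toReal * eLpNorm (fun r : Set.Ioi (0:ℝ) => Q r) p (rad m) ≤
    eLpNorm (mvEval P) p
      (volume.restrict (Metric.closedBall (0 : EuclideanSpace ℝ (Fin m)) 1)) := by
  rw [← eLpNorm_comp_measurePreserving (continuous_mvEval _).aestronglyMeasurable (mp_ball hm)]
  set s := sph m Set.univ with hs
  have hs0 : s ≠ 0 := sph_univ_ne_zero hm
  have hst : s ≠ ∞ := measure_ne_top _ _
  set μ := s⁻¹ • sph m with hμ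
  have : IsProbabilityMeasure μ := ⟨by
    rw [hμ, Measure.smul_apply, smul_eq_mul, ← hs, ENNReal.inv_mul_cancel hs0 hst]⟩
  have hμs : sph m = s • μ := by
    rw [hμ, smul_smul, ENNReal.mul_inv_cancel hs0 hst, one_smul]
  set F := (mvEval P ∘
      (fun z : Metric.sphere (0 : EuclideanSpace ℝ (Fin m)) 1 × Set.Ioi (0:ℝ) =>
      (z.2 : ℝ) • (z.1 : EuclideanSpace ℝ (Fin m)))) with hF
  have hFc : Continuous F := (continuous_mvEval P).comp (by fun_prop)
  have h1 := eLpNorm_integral_le μ (rad m) p hp F hFc.stronglyMeasurable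
  have h2 : (fun r : Set.Ioi (0:ℝ) => Q r) = (fun b => ∫ a, F (a, b) ∂μ) := by
    ext r
    rw [hμ, integral_smul_measure]
    have h := hQ r r.2
    simp only [hF, Function.comp]
    rw [← h, Sph_one]
    have : (sph m).real Set.univ ≠ 0 := by
      rw [measureReal_def]
      exact (ENNReal.toReal_pos hs0 hst).ne'
    rw [ENNReal.toReal_inv, hs, ← measureReal_def, Complex.real_smul]
    push_cast
    have h' : ((sph m).real Set.univ : ℂ) ≠ 0 := by exact_mod_cast this
    field_simp
  rw [h2]
  have h3 : (sph m).prod (rad m) = s • (μ.prod (rad m)) := by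
    conv_lhs => rw [hμs]
    rw [Measure.prod_smul_left]
  rw [h3, eLpNorm_smul_measure_of_ne_zero hs0, smul_eq_mul]
  gcongr

theorem sph_univ_eq {m : ℕ} (hm : 1 ≤ m) : sph m Set.univ =
    ENNReal.ofReal (2 * Real.pi ^ ((m : ℝ) / 2) / Real.Gamma ((m : ℝ) / 2)) := by
  have : Nonempty (Fin m) := ⟨⟨0, hm⟩⟩
  have hm' : (0:ℝ) < m := by exact_mod_cast hm
  rw [Measure.toSphere_apply_univ, EuclideanSpace.volume_ball]
  simp only [finrank_euclideanSpace, Fintype.card_fin, ENNReal.ofReal_one, one_pow, one_mul]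
  rw [← ENNReal.ofReal_natCast, ← ENNReal.ofReal_mul (by positivity)]
  congr 1
  rw [Real.Gamma_add_one (by positivity), Real.sqrt_eq_rpow, ← Real.rpow_natCast,
    ← Real.rpow_mul Real.pi_pos.le]
  have : Real.Gamma ((m:ℝ)/2) ≠ 0 := (Real.Gamma_pos_of_pos (by positivity)).ne'
  rw [show (1/2 * (m:ℝ)) = m/2 by ring]
  field_simp

theorem const_eq {m : ℕ} (hm : 1 ≤ m) (p : ℝ≥0∞) :
    ENNReal.ofReal
      ((2 / (2 * Real.pi ^ ((m : ℝ) / 2) / Real.Gamma ((m : ℝ) / 2))) ^ (1 / p.toReal)) *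
      (sph m Set.univ) ^ (1 / p).toReal = 2 ^ (1 / p).toReal := by
  have hm' : (0:ℝ) < m := by exact_mod_cast hm
  have hG : 0 < Real.Gamma ((m:ℝ)/2) := Real.Gamma_pos_of_pos (by positivity)
  rw [sph_univ_eq hm]
  set S := 2 * Real.pi ^ ((m : ℝ) / 2) / Real.Gamma ((m : ℝ) / 2) with hS
  have hSpos : 0 < S := by positivity
  have : (1 / p).toReal = 1 / p.toReal := by simp
  rw [this, ← ENNReal.ofReal_rpow_of_pos (by positivity), ← ENNReal.mul_rpow_of_nonneg _ _ (by positivity),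
    ← ENNReal.ofReal_mul (by positivity), div_mul_cancel₀ _ hSpos.ne']
  simp

/-! ### Symmetrization -/

theorem sum_even_aux (f : ℕ → ℂ) (hf : ∀ k, Odd k → f k = 0) (n : ℕ) :
    ∑ k ∈ Finset.range (n + 1), f k = ∑ k ∈ Finset.range (n / 2 + 1), f (2 * k) := by
  induction n with
  | zero => simp
  | succ n ih =>
    rw [Finset.sum_range_succ, ih]
    rcases Nat.even_or_odd (n + 1) with h | h
    · obtain ⟨c, hc⟩ := h
      rw [show (n + 1) / 2 + 1 = (n / 2 + 1) + 1 by omega, Finset.sum_range_succ (n := n / 2 + 1)]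
      rw [show 2 * (n / 2 + 1) = n + 1 by omega]
    · rw [hf _ h, add_zero]
      obtain ⟨c, hc⟩ := h
      rw [show (n + 1) / 2 = n / 2 by omega]

theorem sum_homog {m n : ℕ} {P : MvPolynomial (Fin m) ℂ} (hP : P.totalDegree ≤ n) :
    P = ∑ k ∈ Finset.range (n + 1), MvPolynomial.homogeneousComponent k P := by
  conv_lhs => rw [← MvPolynomial.sum_homogeneousComponent P]
  apply Finset.sum_subset
  · intro k hk
    simp only [Finset.mem_range] at hk ⊢
    omega
  · intro k _ hk
    apply MvPolynomial.homogeneousComponent_eq_zero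
    simp only [Finset.mem_range] at hk
    omega

/-- Spherical mean of `P` as a polynomial in `r ^ 2`. -/
def symQ {m : ℕ} (n : ℕ) (P : MvPolynomial (Fin m) ℂ) : Polynomial ℂ :=
  ∑ k ∈ Finset.range (n / 2 + 1),
    C (Sph (MvPolynomial.homogeneousComponent (2 * k) P) / Sph (1 : MvPolynomial (Fin m) ℂ)) * X ^ k

theorem symQ_natDegree {m : ℕ} (n : ℕ) (P : MvPolynomial (Fin m) ℂ) :
    (symQ n P).natDegree ≤ n / 2 := by
  apply Polynomial.natDegree_sum_le_of_forall_le
  intro k hk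
  have := Finset.mem_range.1 hk
  exact (natDegree_C_mul_X_pow_le _ _).trans (by omega)

/-- The functional `P ↦ Δ^N P (0)`. -/
def Lf (m N : ℕ) (P : MvPolynomial (Fin m) ℂ) : ℂ := mvEval ((lapP m)^[N] P) 0

theorem Lf_add {m N : ℕ} (P Q : MvPolynomial (Fin m) ℂ) : Lf m N (P + Q) = Lf m N P + Lf m N Q := by
  simp only [Lf, ← Module.End.pow_apply, map_add, mvEval]

theorem Lf_smul {m N : ℕ} (a : ℂ) (P : MvPolynomial (Fin m) ℂ) : Lf m N (a • P) = a * Lf m N P := by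
  simp only [Lf, ← Module.End.pow_apply, map_smul, mvEval, MvPolynomial.smul_eval]

theorem Lf_zero {m N : ℕ} : Lf m N 0 = 0 := by
  have := Lf_smul (m := m) (N := N) 0 0
  simpa using this

theorem Lf_sum {m N : ℕ} {ι : Type*} (s : Finset ι) (f : ι → MvPolynomial (Fin m) ℂ) :
    Lf m N (∑ i ∈ s, f i) = ∑ i ∈ s, Lf m N (f i) := by
  classical
  induction s using Finset.induction_on with
  | empty => simp [Lf_zero]
  | insert a s ha ih => rw [Finset.sum_insert ha, Lf_add, ih, Finset.sum_insert ha]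

theorem Lf_symQ {m n : ℕ} (hm : 1 ≤ m) (N : ℕ) {P : MvPolynomial (Fin m) ℂ}
    (hP : P.totalDegree ≤ n) : Lf m N P = Lf m N (aeval (sqP m) (symQ n P)) := by
  have hh := fun k => MvPolynomial.homogeneousComponent_isHomogeneous k P
  conv_lhs => rw [sum_homog hP]
  rw [Lf_sum, sum_even_aux]
  · rw [symQ, map_sum, Lf_sum]
    apply Finset.sum_congr rfl
    intro k _
    rw [map_mul, map_pow, aeval_X, aeval_C, ← Algebra.smul_def, Lf_smul]
    by_cases hk : k = N
    · subst hk
      exact pizzetti hm k (hh _)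
    · have h1 : Lf m N (MvPolynomial.homogeneousComponent (2 * k) P) = 0 :=
        lapP_iter_zero_of_ne (hh _) (by omega)
      have h2 : Lf m N (sqP m ^ k) = 0 :=
        lapP_iter_zero_of_ne ((isHomogeneous_sqP m).pow k) (by omega)
      rw [h1, h2, mul_zero]
  · intro k hk
    apply lapP_iter_zero_of_ne (hh k)
    rintro rfl
    exact (Nat.not_odd_iff_even.2 (even_two_mul N)) hk

theorem symQ_mean {m n : ℕ} (hm : 1 ≤ m) {P : MvPolynomial (Fin m) ℂ}
    (hP : P.totalDegree ≤ n) (r : ℝ) :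
    (expand ℂ 2 (symQ n P)).eval (r : ℂ) * Sph (1 : MvPolynomial (Fin m) ℂ) =
      ∫ θ : Metric.sphere (0 : EuclideanSpace ℝ (Fin m)) 1,
        mvEval P (r • (θ : EuclideanSpace ℝ (Fin m))) ∂(sph m) := by
  have hh := fun k => MvPolynomial.homogeneousComponent_isHomogeneous k P
  have h1 : ∀ θ : Metric.sphere (0 : EuclideanSpace ℝ (Fin m)) 1,
      mvEval P (r • (θ : EuclideanSpace ℝ (Fin m))) = ∑ k ∈ Finset.range (n + 1),
        (r : ℂ) ^ k * mvEval (MvPolynomial.homogeneousComponent k P) θ := by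
    intro θ
    conv_lhs => rw [sum_homog hP]
    rw [show mvEval (∑ k ∈ Finset.range (n + 1), MvPolynomial.homogeneousComponent k P)
      (r • (θ : EuclideanSpace ℝ (Fin m))) = ∑ k ∈ Finset.range (n + 1),
        mvEval (MvPolynomial.homogeneousComponent k P) (r • (θ : EuclideanSpace ℝ (Fin m))) by
        simp [mvEval]]
    exact Finset.sum_congr rfl fun k _ => mvEval_smul (hh k) _ _
  simp only [h1]
  have hS := Sph_one_ne_zero hm
  rw [integral_finset_sum]
  · simp only [integral_const_mul]
    rw [sum_even_aux, symQ, map_sum, eval_finset_sum, Finset.sum_mul]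
    · apply Finset.sum_congr rfl
      intro k _
      rw [expand_eval]
      simp only [eval_mul, eval_C, eval_pow, eval_X, ← pow_mul]
      rw [mul_right_comm, div_mul_cancel₀ _ hS, mul_comm]
      rfl
    · intro k hk
      have : ∫ θ : Metric.sphere (0 : EuclideanSpace ℝ (Fin m)) 1,
          mvEval (MvPolynomial.homogeneousComponent k P) θ ∂(sph m) = 0 := Sph_odd hk (hh k)
      rw [this, mul_zero]
  · intro k _
    have hc : Continuous (fun θ : Metric.sphere (0 : EuclideanSpace ℝ (Fin m)) 1 =>
        (r : ℂ) ^ k * mvEval (MvPolynomial.homogeneousComponent k P) θ) :=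
      continuous_const.mul ((continuous_mvEval _).comp continuous_subtype_val)
    exact hc.integrable_of_hasCompactSupport (HasCompactSupport.of_compactSpace _)

/-- **Corollary 2.11.**  For `m, n ≥ 1`, `N ≥ 0` and `p ∈ [1,∞]`, the sharp constant in
the Markov–Bernstein–Nikolskii inequality `|Δ^N P(0)| ≤ C ‖P‖_{L_p(𝔹^m)}` over
polynomials of degree at most `n` in `m` variables equals
`(2/|S^{m-1}|)^{1/p}` times the corresponding sharp constant for even univariate
polynomials of degree at most `2⌊n/2⌋` with the Bessel operator `(Be_{m/2-1})^N`
in `L_p` on `[-1,1]` with weight `|t|^{m-1}`  (`1/∞ = 0`). -/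
theorem sharp_constant_ball_eq_univariate_bessel
    {m n : ℕ} (hm : 1 ≤ m) (hn : 1 ≤ n) (N : ℕ) (p : ℝ≥0∞) (hp : 1 ≤ p) :
    (⨆ (P : MvPolynomial (Fin m) ℂ) (_ : P.totalDegree ≤ n ∧ P ≠ 0),
        (‖(lap (m := m))^[N] (mvEval P) 0‖₊ : ℝ≥0∞) /
          eLpNorm (mvEval P) p (volume.restrict (Metric.closedBall (0 : EuclideanSpace ℝ (Fin m)) 1)))
      = ENNReal.ofReal
          ((2 / (2 * Real.pi ^ ((m : ℝ) / 2) / Real.Gamma ((m : ℝ) / 2))) ^ (1 / p.toReal)) *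
        ⨆ (Q : Polynomial ℂ)
          (_ : Q.natDegree ≤ 2 * (n / 2) ∧ (∀ z : ℂ, Q.eval (-z) = Q.eval z) ∧ Q ≠ 0),
          (‖(besselOp ((m : ℝ) / 2 - 1))^[N] (fun z => Q.eval z) 0‖₊ : ℝ≥0∞) /
            eLpNorm (fun t : ℝ => Q.eval (t : ℂ)) p
              ((volume.restrict (Set.Icc (-1 : ℝ) 1)).withDensity
                fun t => ENNReal.ofReal (|t| ^ (m - 1))) := by
  have hop : ∀ P : MvPolynomial (Fin m) ℂ, (lap (m := m))^[N] (mvEval P) 0 = Lf m N P := fun P => by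
    rw [lap_iter_mvEval]; rfl
  set K := ENNReal.ofReal
    ((2 / (2 * Real.pi ^ ((m : ℝ) / 2) / Real.Gamma ((m : ℝ) / 2))) ^ (1 / p.toReal)) with hK
  have hm' : (0:ℝ) < m := by exact_mod_cast hm
  have hK0 : K ≠ 0 := by
    have hG : 0 < Real.Gamma ((m:ℝ)/2) := Real.Gamma_pos_of_pos (by positivity)
    rw [hK, Ne, ENNReal.ofReal_eq_zero, not_le]
    positivity
  have hKt : K ≠ ∞ := ENNReal.ofReal_ne_top
  have hconst := const_eq hm p
  rw [← hK] at hconst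
  have hdiv : ∀ a b : ℝ≥0∞, K * (a / (K * b)) = a / b := by
    intro a b
    rw [← mul_div_assoc, ENNReal.mul_div_mul_left _ _ hK0 hKt]
  apply le_antisymm
  · refine iSup₂_le fun P hP => ?_
    have hle : eLpNorm (fun t : ℝ => (expand ℂ 2 (symQ n P)).eval (t : ℂ)) p (wV m) ≤
        K * eLpNorm (mvEval P) p
          (volume.restrict (Metric.closedBall (0 : EuclideanSpace ℝ (Fin m)) 1)) := by
      rw [eLpNorm_wV, ← hconst, mul_assoc]
      gcongr
      exact eLpNorm_ball_ge hm P (fun r : ℝ => (expand ℂ 2 (symQ n P)).eval (r : ℂ)) p hp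
        fun r _ => symQ_mean hm hP.1 r
    rw [hop, Lf_symQ hm N hP.1]
    by_cases hq : symQ n P = 0
    · rw [hq, map_zero, Lf_zero]
      simp
    · refine le_trans ?_ (mul_le_mul_right (le_iSup₂_of_le (expand ℂ 2 (symQ n P)) ⟨?_, ?_, ?_⟩ le_rfl) K)
      · rw [← op_eq, hop, ← hdiv]
        exact mul_le_mul_right (ENNReal.div_le_div_left hle _) K
      · rw [natDegree_expand]
        have := symQ_natDegree n P
        omega
      · intro z
        simp [expand_eval]
      · exact (expand_ne_zero (by norm_num)).2 hq
  · rw [ENNReal.mul_iSup]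
    refine iSup_le fun Q => ?_
    rw [ENNReal.mul_iSup]
    refine iSup_le fun hQ => ?_
    obtain ⟨hdeg, heven, hne⟩ := hQ
    obtain ⟨q, rfl⟩ : ∃ q, Q = expand ℂ 2 q := ⟨_, even_eq_expand Q heven⟩
    have heq : eLpNorm (fun t : ℝ => (expand ℂ 2 q).eval (t : ℂ)) p (wV m) =
        K * eLpNorm (mvEval (aeval (sqP m) q)) p
          (volume.restrict (Metric.closedBall (0 : EuclideanSpace ℝ (Fin m)) 1)) := by
      rw [eLpNorm_wV, ← hconst, mul_assoc, eLpNorm_ball_radial hm]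
    change K * (_ / eLpNorm _ p (wV m)) ≤ _
    rw [heq, hdiv, ← op_eq]
    by_cases h0 : aeval (sqP m) q = 0
    · rw [hop, h0, Lf_zero]
      simp
    · refine le_iSup₂_of_le (aeval (sqP m) q) ⟨?_, h0⟩ le_rfl
      rw [natDegree_expand] at hdeg
      have := totalDegree_aeval (m := m) q
      omega
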